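/- Let G be a finite connected distance-hereditary graph. Then every vertex v with e(v) > rad(G) either has a neighbor w with e(w) < e(v), or else e(v) = rad(G) + 1, diam(G) = 2·rad(G), and d(v, C(G)) = 2. -/

import Mathlib

/-- A graph is distance-hereditary if every connected induced subgraph is isometric
(equivalently, every induced path is a shortest path). -/
def DistHereditary {V : Type*} (G : SimpleGraph V) : Prop :=
  ∀ s : Set V, (G.induce s).Connected →
    ∀ u v : s, (G.induce s).dist u v = G.dist (u : V) (v : V)

/-- Eccentricity of a vertex: `e(v) = max_{u} d(v,u)`. -/
noncomputable def ecc {V : Type*} [Fintype V] (G : SimpleGraph V) (v : V) : ℕ :=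
  Finset.univ.sup (fun u => G.dist v u)

/-- Radius: minimum eccentricity. -/
noncomputable def rad {V : Type*} [Fintype V] (G : SimpleGraph V) : ℕ :=
  sInf (Set.range (ecc G))

/-- Diameter: maximum eccentricity. -/
noncomputable def diam {V : Type*} [Fintype V] (G : SimpleGraph V) : ℕ :=
  Finset.univ.sup (fun v => ecc G v)

/-- The center: vertices of minimum eccentricity. -/
def center {V : Type*} [Fintype V] (G : SimpleGraph V) : Set V :=
  {v | ecc G v = rad G}

/-- Distance from a vertex to a set of vertices: `d(v,S) = min_{s ∈ S} d(v,s)`. -/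
noncomputable def distToSet {V : Type*} (G : SimpleGraph V) (v : V) (S : Set V) : ℕ :=
  sInf ((G.dist v) '' S)

/-- The interval `I(x,y)`: vertices on shortest `(x,y)`-paths. -/
def interval {V : Type*} (G : SimpleGraph V) (x y : V) : Set V :=
  {v | G.dist x v + G.dist v y = G.dist x y}

/-- The intervalSlice `S_k(x,y) = {v ∈ I(x,y) : d(x,v) = k}`. -/
def intervalSlice {V : Type*} (G : SimpleGraph V) (x y : V) (k : ℕ) : Set V :=
  {v | v ∈ interval G x y ∧ G.dist x v = k}

/-- The set `S` induces a cograph in `G`: no induced path on four vertices within `S`. -/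
def IsCographOn {V : Type*} (G : SimpleGraph V) (S : Set V) : Prop :=
  ¬ ∃ a b c d : V, a ∈ S ∧ b ∈ S ∧ c ∈ S ∧ d ∈ S ∧
    a ≠ c ∧ a ≠ d ∧ b ≠ d ∧
    G.Adj a b ∧ G.Adj b c ∧ G.Adj c d ∧ ¬ G.Adj a c ∧ ¬ G.Adj a d ∧ ¬ G.Adj b d

section DistanceHereditary

open SimpleGraph

variable {V : Type*} {G : SimpleGraph V}

/-- `x` and `y` are joined by a walk avoiding the ball of radius `k` around `u`. -/
def LinkedOutside (G : SimpleGraph V) (u : V) (k : ℕ) (x y : V) : Prop :=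
  ∃ W : G.Walk x y, ∀ w ∈ W.support, k < G.dist u w

theorem LinkedOutside.symm {u x y : V} {k : ℕ} (h : LinkedOutside G u k x y) :
    LinkedOutside G u k y x := by
  obtain ⟨W, hW⟩ := h
  exact ⟨W.reverse, by simpa using hW⟩

theorem LinkedOutside.trans {u x y z : V} {k : ℕ} (h : LinkedOutside G u k x y)
    (h' : LinkedOutside G u k y z) : LinkedOutside G u k x z := by
  obtain ⟨W, hW⟩ := h
  obtain ⟨W', hW'⟩ := h'
  refine ⟨W.append W', fun w hw => ?_⟩
  rcases (Walk.mem_support_append_iff _ _).1 hw with h | h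
  exacts [hW w h, hW' w h]

theorem LinkedOutside.of_adj {u x y : V} {k : ℕ} (h : G.Adj x y) (hx : k < G.dist u x)
    (hy : k < G.dist u y) : LinkedOutside G u k x y :=
  ⟨h.toWalk, by simp [hx, hy]⟩

theorem LinkedOutside.lt_dist_right {u x y : V} {k : ℕ} (h : LinkedOutside G u k x y) :
    k < G.dist u y := by
  obtain ⟨W, hW⟩ := h
  exact hW y W.end_mem_support

/-- The vertices of a walk realizing the distance lie on a geodesic. -/
theorem dist_add_dist_of_mem_support {x y w : V} (W : G.Walk x y)
    (hW : W.length = G.dist x y) (hw : w ∈ W.support) :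
    G.dist x w + G.dist w y ≤ G.dist x y := by
  classical
  have h := congrArg Walk.length (W.take_spec hw)
  rw [Walk.length_append] at h
  have h₁ := dist_le (W.takeUntil w hw)
  have h₂ := dist_le (W.dropUntil w hw)
  omega

/-- A geodesic towards a sufficiently far vertex avoids the ball. -/
theorem LinkedOutside.of_dist_le (hconn : G.Connected) {u t x : V} {k : ℕ}
    (ht : k < G.dist u t) (h : G.dist t x + k ≤ G.dist u x) : LinkedOutside G u k t x := by
  obtain ⟨W, hW⟩ := hconn.exists_walk_length_eq_dist t x
  refine ⟨W, fun w hw => ?_⟩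
  have h₁ := dist_add_dist_of_mem_support W hW hw
  have h₂ := hconn.dist_triangle (u := u) (v := w) (w := x)
  rcases eq_or_ne t w with rfl | hne
  · exact ht
  · have := hconn.pos_dist_of_ne hne
    omega

/-- Every vertex other than `u` has a neighbor closer to `u`. -/
theorem exists_adj_dist_eq (hconn : G.Connected) {u x : V} {k : ℕ} (h : G.dist x u = k + 1) :
    ∃ t, G.Adj x t ∧ G.dist t u = k := by
  obtain ⟨W, hW⟩ := hconn.exists_walk_length_eq_dist x u
  cases W with
  | nil => simp at h
  | @cons _ t _ hadj W' =>
    refine ⟨t, hadj, ?_⟩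
    have h₁ := dist_le W'
    have h₂ := hconn.dist_triangle (u := x) (v := t) (w := u)
    rw [dist_eq_one_iff_adj.2 hadj] at h₂
    rw [Walk.length_cons] at hW
    omega

/-- A walk leaving a set crosses its boundary. -/
theorem exists_boundary_dist_add_le (S : Set V) {x y : V} (W : G.Walk x y) (hx : x ∈ S)
    (hy : y ∉ S) : ∃ s t, G.Adj s t ∧ s ∈ S ∧ t ∉ S ∧ G.dist x t + G.dist t y ≤ W.length := by
  classical
  obtain ⟨d, hd, h₁, h₂⟩ := W.exists_boundary_dart S hx hy
  refine ⟨d.fst, d.snd, d.adj, h₁, h₂, ?_⟩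
  have hw := W.dart_snd_mem_support_of_mem_darts hd
  have h := congrArg Walk.length (W.take_spec hw)
  rw [Walk.length_append] at h
  have h₁ := dist_le (W.takeUntil _ hw)
  have h₂ := dist_le (W.dropUntil _ hw)
  omega

/-- In a distance-hereditary graph, two vertices at level `k + 1` from `u` that are joined outside
the ball of radius `k` have the same neighbors at level `k`. -/
theorem DistHereditary.adj_of_linkedOutside (hconn : G.Connected) (hdh : DistHereditary G)
    {u x y z : V} {k : ℕ} (hxy : LinkedOutside G u k x y) (hy : G.dist u y = k + 1)
    (hz : G.dist u z = k) (hxz : G.Adj x z) : G.Adj y z := by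
  obtain ⟨W, hW⟩ := hxy.symm
  obtain ⟨P, hP⟩ := hconn.exists_walk_length_eq_dist z u
  set Q : G.Walk y u := W.append (Walk.cons hxz P)
  have hs := Q.connected_induce_support
  obtain ⟨t, ht, htu⟩ := exists_adj_dist_eq (k := k) hs
    (x := ⟨y, Q.start_mem_support⟩) (u := ⟨u, Q.end_mem_support⟩)
    (by rw [hdh _ hs]; simpa [SimpleGraph.dist_comm] using hy)
  replace htu : G.dist (t : V) u = k := (hdh _ hs _ _).symm.trans htu
  have hyt : G.Adj y t := ht
  suffices h : (t : V) = z from h ▸ hyt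
  have htP : (t : V) ∈ P.support := by
    rcases (Walk.mem_support_append_iff _ _).1 t.2 with h | h
    · have := hW _ h
      rw [SimpleGraph.dist_comm] at htu
      omega
    · rcases (by simpa using h : (t : V) = x ∨ (t : V) ∈ P.support) with h | h
      · have := hW _ W.end_mem_support
        rw [SimpleGraph.dist_comm, h] at htu
        omega
      · exact h
  have := dist_add_dist_of_mem_support P hP htP
  rw [SimpleGraph.dist_comm] at hz
  exact (hconn.dist_eq_zero_iff.1 (by omega)).symm

/-- The common neighborhoods of `v` and vertices at distance two form a laminar family. -/
theorem DistHereditary.commonNeighbors_laminar (hconn : G.Connected) (hdh : DistHereditary G)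
    {v a b : V} (ha : G.dist v a = 2) (hb : G.dist v b = 2)
    (hne : (G.commonNeighbors v a ∩ G.commonNeighbors v b).Nonempty) :
    G.commonNeighbors v a ⊆ G.commonNeighbors v b ∨
      G.commonNeighbors v b ⊆ G.commonNeighbors v a := by
  by_contra! hcon
  obtain ⟨q, ⟨hvq, haq⟩, hqb⟩ := Set.not_subset.1 hcon.1
  obtain ⟨q', ⟨hvq', hbq'⟩, hqa'⟩ := Set.not_subset.1 hcon.2
  obtain ⟨p, ⟨-, hap⟩, -, hbp⟩ := hne
  have hbq : ¬ G.Adj b q := fun h => hqb ⟨hvq, h⟩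
  have haq' : ¬ G.Adj a q' := fun h => hqa' ⟨hvq', h⟩
  simp only [mem_neighborSet] at hvq haq hvq' hbq' hap hbp
  have lt_dist : ∀ w, a ≠ w → ¬ G.Adj a w → 1 < G.dist a w := fun w hw hn => by
    have h₁ := hconn.pos_dist_of_ne hw
    have h₂ := mt dist_eq_one_iff_adj.1 hn
    omega
  have hab : ¬ G.Adj a b := fun h => hbq <|
    hdh.adj_of_linkedOutside (u := v) (k := 1) hconn (.of_adj h (by omega) (by omega)) hb
      (dist_eq_one_iff_adj.2 hvq) haq
  have hb1 : 1 < G.dist a b := lt_dist b (by rintro rfl; exact hbq haq) hab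
  have hq1 : 1 < G.dist a q' := lt_dist q'
    (by rintro rfl; rw [dist_eq_one_iff_adj.2 hvq'] at ha; omega) haq'
  have hb2 : G.dist a b = 2 := by
    have := hconn.dist_triangle (u := a) (v := p) (w := b)
    rw [dist_eq_one_iff_adj.2 hap, dist_eq_one_iff_adj.2 hbp.symm] at this
    omega
  rw [SimpleGraph.dist_comm] at ha
  exact hbq <| hdh.adj_of_linkedOutside (u := a) (k := 1) hconn
    ((LinkedOutside.of_adj hvq' (by omega) hq1).trans (.of_adj hbq'.symm hq1 hb1)) hb2
    (dist_eq_one_iff_adj.2 haq) hvq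

/-- A walk from `x` to a vertex not linked to `x` outside the unit ball around `v` goes through a
common neighbor of `v` and `a`, where `a` is linked to `x` at distance two from `v`. -/
theorem DistHereditary.exists_mem_commonNeighbors (hconn : G.Connected) (hdh : DistHereditary G)
    {v a x y : V} (ha : G.dist v a = 2) (hax : LinkedOutside G v 1 a x)
    (hxy : ¬ LinkedOutside G v 1 x y) :
    ∃ p ∈ G.commonNeighbors v a, G.dist x p + G.dist p y ≤ G.dist x y := by
  obtain ⟨W, hW⟩ := hconn.exists_walk_length_eq_dist x y
  obtain ⟨s, p, hsp, hs, hp, hle⟩ := exists_boundary_dist_add_le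
    {w | LinkedOutside G v 1 x w} W
    (⟨Walk.nil, by simpa using hax.lt_dist_right⟩ : LinkedOutside G v 1 x x) hxy
  simp only [Set.mem_ofPred_eq] at hs hp
  have hs1 := hs.lt_dist_right
  have hp1 : G.dist v p ≤ 1 := by
    by_contra! h
    exact hp (hs.trans (.of_adj hsp hs1 h))
  have htri := hconn.dist_triangle (u := v) (v := p) (w := s)
  rw [dist_eq_one_iff_adj.2 hsp.symm] at htri
  have hvp : G.dist v p = 1 := by omega
  exact ⟨p, ⟨dist_eq_one_iff_adj.1 hvp,
    hdh.adj_of_linkedOutside hconn (hax.trans hs).symm ha hvp hsp⟩, hW ▸ hle⟩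

/-- If the common neighborhoods of `v` with `a` and `b` are disjoint, then geodesics between
vertices beyond `a` and `b` pass through both of these neighborhoods. -/
theorem DistHereditary.exists_dist_add_le_of_disjoint (hconn : G.Connected)
    (hdh : DistHereditary G) {v a b x y : V} (ha : G.dist v a = 2) (hb : G.dist v b = 2)
    (hax : LinkedOutside G v 1 a x) (hby : LinkedOutside G v 1 b y)
    (hdis : ¬ (G.commonNeighbors v a ∩ G.commonNeighbors v b).Nonempty) :
    ∃ p ∈ G.commonNeighbors v a, ∃ q ∈ G.commonNeighbors v b, p ≠ q ∧
      G.dist x p + G.dist p q + G.dist q y ≤ G.dist x y := by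
  have hxy : ¬ LinkedOutside G v 1 x y := fun h => by
    rw [SimpleGraph.dist_comm] at ha
    obtain ⟨w, haw, hwv⟩ := exists_adj_dist_eq hconn ha
    rw [SimpleGraph.dist_comm] at ha hwv
    have hvw := dist_eq_one_iff_adj.1 hwv
    exact hdis ⟨w, ⟨hvw, haw⟩, hvw, hdh.adj_of_linkedOutside hconn
      ((hax.trans h).trans hby.symm) hb hwv haw⟩
  obtain ⟨p, hp, hple⟩ := hdh.exists_mem_commonNeighbors hconn ha hax hxy
  have hyp : ¬ LinkedOutside G v 1 y p := fun h => by
    have := h.lt_dist_right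
    rw [dist_eq_one_iff_adj.2 hp.1] at this
    omega
  obtain ⟨q, hq, hqle⟩ := hdh.exists_mem_commonNeighbors hconn hb hby hyp
  refine ⟨p, hp, q, hq, fun h => hdis ⟨p, hp, h ▸ hq⟩, ?_⟩
  rw [SimpleGraph.dist_comm (u := y) (v := q), SimpleGraph.dist_comm (u := q) (v := p),
    SimpleGraph.dist_comm (u := y) (v := p)] at hqle
  omega

/-- A vertex at distance at least two from `v` has a vertex at distance two from `v` on a
geodesic to `v`. -/
theorem exists_dist_eq_two (hconn : G.Connected) {v x : V} (h : 2 ≤ G.dist v x) :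
    ∃ a, G.dist v a = 2 ∧ G.dist a x + 2 = G.dist v x := by
  obtain ⟨m, hm⟩ := Nat.exists_eq_add_of_le' h
  obtain ⟨w, hvw, hw⟩ := exists_adj_dist_eq (k := m + 1) hconn hm
  obtain ⟨a, hwa, ha⟩ := exists_adj_dist_eq hconn hw
  refine ⟨a, ?_, by omega⟩
  have h₁ := hconn.dist_triangle (u := v) (v := w) (w := a)
  have h₂ := hconn.dist_triangle (u := v) (v := a) (w := x)
  rw [dist_eq_one_iff_adj.2 hvw, dist_eq_one_iff_adj.2 hwa] at h₁
  omega

/-- If `v` has eccentricity at most `n + 1` and the pairwise distances of vertices far from `v` are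
bounded, then some neighbor of `v` has eccentricity at most `n`. -/
theorem DistHereditary.exists_adj_forall_dist_le [Finite V] (hconn : G.Connected)
    (hdh : DistHereditary G) {v : V} {n : ℕ} (hn : 2 ≤ n) (hle : ∀ x, G.dist v x ≤ n + 1)
    (hfar : ∃ x, n ≤ G.dist v x) (hpair : ∀ x y, G.dist x y ≤ 2 * n)
    (hlt : ∀ x y, G.dist v x = n → n ≤ G.dist v y → G.dist x y < 2 * n) :
    ∃ w, G.Adj v w ∧ ∀ x, G.dist w x ≤ n := by
  have := Fintype.ofFinite V
  classical
  have hex : ∀ x : V, ∃ a, n ≤ G.dist v x → G.dist v a = 2 ∧ G.dist a x + 2 = G.dist v x :=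
    fun x => by
      by_cases h : n ≤ G.dist v x
      · obtain ⟨a, ha⟩ := exists_dist_eq_two hconn (hn.trans h)
        exact ⟨a, fun _ => ha⟩
      · exact ⟨x, fun h' => absurd h' h⟩
  choose a ha using hex
  obtain ⟨z, hz⟩ := hfar
  obtain ⟨x, hxT, hmin⟩ := Finset.exists_min_image {x : V | n ≤ G.dist v x}
    (fun x => (G.commonNeighbors v (a x)).ncard) ⟨z, by simpa using hz⟩
  simp only [Finset.mem_filter, Finset.mem_univ, true_and] at hxT hmin
  obtain ⟨hvax, hax⟩ := ha x hxT
  obtain ⟨p', hp', hp'v⟩ := exists_adj_dist_eq hconn ((SimpleGraph.dist_comm (G := G)).trans hvax)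
  have hvp' : G.Adj v p' := (dist_eq_one_iff_adj.1 hp'v).symm
  refine ⟨p', hvp', fun y => ?_⟩
  by_contra! hy
  have hp'y := hconn.dist_triangle (u := p') (v := v) (w := y)
  rw [hp'v] at hp'y
  have hyT : n ≤ G.dist v y := by omega
  obtain ⟨hvay, hay⟩ := ha y hyT
  have hlex := hle x
  have hley := hle y
  by_cases hne : (G.commonNeighbors v (a x) ∩ G.commonNeighbors v (a y)).Nonempty
  · have hsub : G.commonNeighbors v (a x) ⊆ G.commonNeighbors v (a y) := by
      rcases hdh.commonNeighbors_laminar hconn hvax hvay hne with h | h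
      · exact h
      · exact (Set.eq_of_subset_of_ncard_le h (hmin y hyT)).ge
    have hadj : G.Adj (a y) p' := (hsub ⟨hvp', hp'⟩).2
    have := hconn.dist_triangle (u := p') (v := a y) (w := y)
    rw [dist_eq_one_iff_adj.2 hadj.symm] at this
    omega
  · obtain ⟨p, ⟨hvp, hap⟩, q, ⟨hvq, haq⟩, hpq, hxy⟩ :=
      hdh.exists_dist_add_le_of_disjoint hconn hvax hvay
        (.of_dist_le (x := x) hconn (by omega) (by omega))
        (.of_dist_le (x := y) hconn (by omega) (by omega)) hne
    simp only [mem_neighborSet] at hvp hap hvq haq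
    have h₁ := hconn.pos_dist_of_ne hpq
    have h₂ := hconn.dist_triangle (u := v) (v := p) (w := x)
    have h₃ := hconn.dist_triangle (u := v) (v := q) (w := y)
    rw [dist_eq_one_iff_adj.2 hvp, SimpleGraph.dist_comm (u := p)] at h₂
    rw [dist_eq_one_iff_adj.2 hvq] at h₃
    have h₄ := hpair x y
    have h₅ := hlt x y
    have h₆ := hlt y x
    rw [SimpleGraph.dist_comm (u := y) (v := x)] at h₆
    have hx : G.dist v x = n := by omega
    have hy' : G.dist v y = n := by omega
    have h₅ := h₅ hx hyT
    have h₇ := hconn.dist_triangle (u := a x) (v := p) (w := y)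
    have h₈ := hconn.dist_triangle (u := p) (v := q) (w := y)
    have h₉ := hconn.dist_triangle (u := x) (v := a x) (w := y)
    rw [dist_eq_one_iff_adj.2 hap] at h₇
    rw [SimpleGraph.dist_comm (u := x) (v := a x)] at h₉
    have hay1 : G.dist y (a x) = n + 1 := by
      rw [SimpleGraph.dist_comm]
      omega
    have hyp1 : n < G.dist y p' := by rwa [SimpleGraph.dist_comm]
    have hadj := hdh.adj_of_linkedOutside hconn
      (.of_adj hp'.symm hyp1 (by omega)) hay1 ((SimpleGraph.dist_comm (G := G)).trans hy') hvp'.symm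
    rw [SimpleGraph.dist_comm, dist_eq_one_iff_adj.2 hadj] at hvax
    omega

/-- A vertex `c` in the middle of a long geodesic is within distance two of every vertex `v`
that is nearly in the middle. -/
theorem DistHereditary.dist_le_two_of_middle (hconn : G.Connected) (hdh : DistHereditary G)
    {v c x y : V} {n : ℕ} (hvx : G.dist v x = n + 1) (hvy : G.dist v y ≤ n + 2)
    (hcx : G.dist c x = n + 1) (hcy : G.dist c y ≤ n + 1) (hxy : 2 * (n + 1) ≤ G.dist x y) :
    G.dist v c ≤ 2 := by
  obtain ⟨z, hcz, hzx⟩ := exists_adj_dist_eq hconn hcx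
  rw [SimpleGraph.dist_comm] at hvx hcx hzx
  have hv : LinkedOutside G x n v y := .of_dist_le hconn (by omega) (by omega)
  have hc : LinkedOutside G x n c y := .of_dist_le hconn (by omega) (by omega)
  have hvz := hdh.adj_of_linkedOutside hconn (hc.trans hv.symm) hvx hzx hcz
  have := hconn.dist_triangle (u := v) (v := z) (w := c)
  rw [dist_eq_one_iff_adj.2 hvz, dist_eq_one_iff_adj.2 hcz.symm] at this
  omega

end DistanceHereditary

theorem dist_le_ecc {V : Type*} [Fintype V] (G : SimpleGraph V) (v u : V) :
    G.dist v u ≤ ecc G v :=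
  Finset.le_sup (f := fun u => G.dist v u) (Finset.mem_univ u)

theorem ecc_le_iff {V : Type*} [Fintype V] {G : SimpleGraph V} {v : V} {n : ℕ} :
    ecc G v ≤ n ↔ ∀ u, G.dist v u ≤ n := by
  simp [ecc]

/-- In a finite connected distance-hereditary graph, every non-central vertex `v`
either has a neighbor of strictly smaller eccentricity, or `e(v) = rad(G)+1`,
`diam(G) = 2·rad(G)`, and `d(v, C(G)) = 2`. -/
theorem almost_unimodal {V : Type*} [Fintype V] (G : SimpleGraph V)
    (hconn : G.Connected) (hdh : DistHereditary G) (v : V)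
    (hv : rad G < ecc G v) :
    (∃ w : V, G.Adj v w ∧ ecc G w < ecc G v) ∨
    (ecc G v = rad G + 1 ∧ diam G = 2 * rad G ∧ distToSet G v (center G) = 2) := by
  have hne : Nonempty V := ⟨v⟩
  obtain ⟨c, hc⟩ : ∃ c, ecc G c = rad G := Nat.sInf_mem (Set.range_nonempty (ecc G))
  by_cases hgood : ∃ w : V, G.Adj v w ∧ ecc G w < ecc G v
  · exact Or.inl hgood
  right
  have hcle : ∀ x, G.dist c x ≤ rad G := fun x => hc ▸ dist_le_ecc G c x
  have htwo : ∀ s ∈ center G, 2 ≤ G.dist v s := by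
    intro s hs
    have hs : ecc G s = rad G := hs
    have h₀ : G.dist v s ≠ 0 := fun h => by
      rw [hconn.dist_eq_zero_iff.1 h] at hv
      omega
    have h₁ : G.dist v s ≠ 1 := fun h => hgood ⟨s, SimpleGraph.dist_eq_one_iff_adj.1 h, hs ▸ hv⟩
    omega
  have hvc := htwo c hc
  have hcv := hcle v
  rw [SimpleGraph.dist_comm] at hcv
  have hpair : ∀ x y, G.dist x y ≤ 2 * rad G := fun x y => by
    have := hconn.dist_triangle (u := x) (v := c) (w := y)
    rw [SimpleGraph.dist_comm (u := x) (v := c)] at this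
    have := hcle x
    have := hcle y
    omega
  obtain ⟨n, hn⟩ : ∃ n, ecc G v = n + 1 := ⟨ecc G v - 1, by omega⟩
  obtain ⟨x, y, hx, hy, hxy⟩ : ∃ x y, G.dist v x = n ∧ n ≤ G.dist v y ∧ 2 * n ≤ G.dist x y := by
    by_contra! hcon
    obtain ⟨w, hw, hwle⟩ := hdh.exists_adj_forall_dist_le hconn (v := v) (n := n) (by omega)
      (fun x => hn ▸ dist_le_ecc G v x)
      (by
        by_contra! h
        have := ecc_le_iff.2 fun u => (h u).le
        omega)
      (fun x y => (hpair x y).trans (by omega)) hcon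
    have := ecc_le_iff.2 hwle
    exact hgood ⟨w, hw, by omega⟩
  have hxyle := hpair x y
  have hnr : n = rad G := by omega
  refine ⟨by omega, le_antisymm ?_ ?_, le_antisymm ?_ ?_⟩
  · exact Finset.sup_le fun z _ => ecc_le_iff.2 (hpair z)
  · exact (hnr ▸ hxy).trans ((dist_le_ecc G x y).trans
      (Finset.le_sup (f := fun v => ecc G v) (Finset.mem_univ x)))
  · refine (Nat.sInf_le (Set.mem_image_of_mem (G.dist v) hc)).trans ?_
    obtain ⟨m, hm⟩ : ∃ m, n = m + 1 := ⟨n - 1, by omega⟩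
    have h₁ := hcle x
    have h₂ := hcle y
    have h₃ := hconn.dist_triangle (u := x) (v := c) (w := y)
    rw [SimpleGraph.dist_comm (u := x) (v := c)] at h₃
    have h₄ := dist_le_ecc G v y
    exact hdh.dist_le_two_of_middle hconn (x := x) (y := y) (n := m)
      (by omega) (by omega) (by omega) (by omega) (by omega)
  · refine le_csInf ⟨_, c, hc, rfl⟩ ?_
    rintro _ ⟨s, hs, rfl⟩
    exact htwo s hs
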